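/- The numbers z(n) of plane 1-2 trees satisfy z(n) ~ n! * (3*sqrt(3)/(2*pi))^(n+1) as n tends to infinity; that is, the limit as n tends to infinity of (z(n)/n!) * (2*pi/(3*sqrt(3)))^(n+1) equals 1. -/

import Mathlib

namespace BalancedTrees

/-- Plane binary trees with vertices labeled by natural numbers;
`nil` is the empty tree, and each child of a vertex is designated
as a left child or a right child. -/
inductive BT where
  | nil : BT
  | node (label : ℕ) (l r : BT) : BT
deriving DecidableEq

namespace BT

/-- `balRank t = some k` if and only if the root of `t` is a balanced vertex of
rank `k`, i.e. every descending path from the root to a leaf has length `k`. -/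
def balRank : BT → Option ℕ
  | .nil => none
  | .node _ .nil .nil => some 0
  | .node _ .nil (.node b rl rr) => (balRank (BT.node b rl rr)).map (· + 1)
  | .node _ (.node a ll lr) .nil => (balRank (BT.node a ll lr)).map (· + 1)
  | .node _ (.node a ll lr) (.node b rl rr) =>
      match balRank (BT.node a ll lr), balRank (BT.node b rl rr) with
      | some i, some j => if i = j then some (i + 1) else none
      | _, _ => none

/-- The number of balanced vertices of rank `k` in the tree `t`. -/
def countBal (k : ℕ) : BT → ℕ
  | .nil => 0
  | .node v l r =>
      countBal k l + countBal k r +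
        (if balRank (BT.node v l r) = some k then 1 else 0)

/-- The number of balanced vertices (of any rank) in the tree `t`. -/
def countBalAll : BT → ℕ
  | .nil => 0
  | .node v l r =>
      countBalAll l + countBalAll r +
        (if (balRank (BT.node v l r)).isSome then 1 else 0)

/-- Auxiliary, fuelled version of `treeOf`. -/
def treeOfAux : ℕ → List ℕ → BT
  | 0, _ => .nil
  | _ + 1, [] => .nil
  | fuel + 1, l =>
      let m := l.foldr max 0
      BT.node m (treeOfAux fuel (l.takeWhile (· != m)))
                (treeOfAux fuel ((l.dropWhile (· != m)).tail))

/-- The decreasing binary tree `T(π)` of a sequence `π` of distinct labels: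
the root is the maximum entry, and its left (resp. right) subtree is built
recursively from the part of the sequence to the left (resp. right) of the
maximum. This is a bijection between permutations of `{1,…,n}` and
decreasing binary trees on `{1,…,n}`. -/
def treeOf (l : List ℕ) : BT := treeOfAux l.length l

/-- Canonical form for non-plane 1-2 trees (as represented by plane trees):
an only child is stored as a left child, and of two (unordered) children the
one with the larger label is stored on the left. Decreasing binary trees in
canonical form are in bijection with non-plane 1-2 trees. -/
def canonNP : BT → Bool
  | .nil => true
  | .node _ l r =>
      canonNP l && canonNP r &&
        (match l, r with
         | .nil, .nil => true
         | .node _ _ _, .nil => true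
         | .nil, .node _ _ _ => false
         | .node a _ _, .node b _ _ => decide (b < a))

/-- Canonical form for plane 1-2 trees: an only child is stored as a left
child (an only child carries no left/right designation), while two children
remain ordered. Decreasing binary trees in canonical form are in bijection
with plane 1-2 trees. -/
def canonP : BT → Bool
  | .nil => true
  | .node _ l r =>
      canonP l && canonP r &&
        (match l, r with
         | .nil, .node _ _ _ => false
         | _, _ => true)

end BT

open BT

/-- The list of all permutations of `{1,…,n}`, each written as a list. -/
def perms (n : ℕ) : List (List ℕ) := (List.range' 1 n).permutations

/-- `a n k`: the total number of balanced vertices of rank `k` over all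
decreasing binary trees on `{1,…,n}`. -/
def a (n k : ℕ) : ℕ := ((perms n).map fun l => countBal k (treeOf l)).sum

/-- `r n k`: the number of decreasing binary trees on `{1,…,n}` whose root is
balanced of rank `k`. -/
def r (n k : ℕ) : ℕ :=
  ((perms n).filter fun l => decide (balRank (treeOf l) = some k)).length

/-- `p n k`: the probability that the root of a uniformly random decreasing
binary tree on `{1,…,n}` is balanced of rank `k`; by convention `p 0 k = 1`. -/
def p (n k : ℕ) : ℚ := if n = 0 then 1 else (r n k : ℚ) / (Nat.factorial n : ℚ)

/-- The number of decreasing binary trees on `{1,…,n}` whose root is balanced. -/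
def rootBal (n : ℕ) : ℕ :=
  ((perms n).filter fun l => (balRank (treeOf l)).isSome).length

/-- `proot n`: the probability that the root of a uniformly random decreasing
binary tree on `{1,…,n}` is balanced. -/
def proot (n : ℕ) : ℚ := (rootBal n : ℚ) / (Nat.factorial n : ℚ)

/-- The total number of balanced vertices over all decreasing binary trees
on `{1,…,n}`. -/
def totalBal (n : ℕ) : ℕ := ((perms n).map fun l => countBalAll (treeOf l)).sum

/-- `Pbal n`: the probability that a vertex chosen uniformly at random from
the `n * n!` vertices of all decreasing binary trees on `{1,…,n}` is balanced. -/
def Pbal (n : ℕ) : ℚ := (totalBal n : ℚ) / ((n : ℚ) * (Nat.factorial n : ℚ))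

/-- Permutations whose decreasing binary tree is a canonical representative
of a non-plane 1-2 tree; these are in bijection with non-plane 1-2 trees
on `{1,…,n}`. -/
def npPerms (n : ℕ) : List (List ℕ) := (perms n).filter fun l => canonNP (treeOf l)

/-- `E n`: the number of non-plane 1-2 trees on `{1,…,n}` (the Euler number). -/
def E (n : ℕ) : ℕ := (npPerms n).length

/-- `b n k`: the total number of balanced vertices of rank `k` over all
non-plane 1-2 trees on `{1,…,n}`. -/
def b (n k : ℕ) : ℕ := ((npPerms n).map fun l => countBal k (treeOf l)).sum

/-- `s n k`: the number of non-plane 1-2 trees on `{1,…,n}` whose root is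
balanced of rank `k`. -/
def s (n k : ℕ) : ℕ :=
  ((npPerms n).filter fun l => decide (balRank (treeOf l) = some k)).length

/-- Permutations whose decreasing binary tree is a canonical representative
of a plane 1-2 tree; these are in bijection with plane 1-2 trees on `{1,…,n}`. -/
def pPerms (n : ℕ) : List (List ℕ) := (perms n).filter fun l => canonP (treeOf l)

/-- `z n`: the number of plane 1-2 trees on `{1,…,n}`. -/
def z (n : ℕ) : ℕ := (pPerms n).length

/-- `d n k`: the total number of balanced vertices of rank `k` over all
plane 1-2 trees on `{1,…,n}`. -/
def d (n k : ℕ) : ℕ := ((pPerms n).map fun l => countBal k (treeOf l)).sum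

/-- `t n k`: the number of plane 1-2 trees on `{1,…,n}` whose root is
balanced of rank `k`. -/
def t (n k : ℕ) : ℕ :=
  ((pPerms n).filter fun l => decide (balRank (treeOf l) = some k)).length

end BalancedTrees

open BalancedTrees

namespace BalancedTrees

namespace BT

/-- Splitting a list at its strict maximum computes the root of `treeOfAux`. -/
theorem treeOfAux_append_cons {l₁ l₂ : List ℕ} {m : ℕ} (h₁ : ∀ x ∈ l₁, x < m)
    (h₂ : ∀ x ∈ l₂, x < m) (f : ℕ) :
    treeOfAux (f + 1) (l₁ ++ m :: l₂) = node m (treeOfAux f l₁) (treeOfAux f l₂) := by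
  have hfold : ∀ (l : List ℕ) (b : ℕ), (∀ x ∈ l, x < m) → b ≤ m → l.foldr max b ≤ m := by
    intro l b hl hb
    induction l with
    | nil => simpa using hb
    | cons a l ih =>
      simp only [List.foldr_cons, max_le_iff]
      exact ⟨(hl a (by simp)).le, ih fun x hx => hl x (by simp [hx])⟩
  have hm : (l₁ ++ m :: l₂).foldr max 0 = m := by
    rw [List.foldr_append, List.foldr_cons, max_eq_left (hfold l₂ 0 h₂ (Nat.zero_le m))]
    clear h₂
    induction l₁ with
    | nil => rfl
    | cons a l ih =>
      rw [List.foldr_cons, ih fun x hx => h₁ x (by simp [hx])]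
      exact max_eq_right (h₁ a (by simp)).le
  have hne : ∀ x ∈ l₁, (x != m) = true := fun x hx => by simpa using (h₁ x hx).ne
  have htake : (l₁ ++ m :: l₂).takeWhile (· != m) = l₁ := by
    rw [List.takeWhile_append_of_pos hne]; simp
  have hdrop : (l₁ ++ m :: l₂).dropWhile (· != m) = m :: l₂ := by
    rw [List.dropWhile_append_of_pos hne]; simp
  obtain ⟨a, l, hal⟩ : ∃ a l, l₁ ++ m :: l₂ = a :: l :=
    List.exists_cons_of_ne_nil (by simp)
  rw [hal, treeOfAux, ← hal]
  · simp only [hm, htake, hdrop, List.tail_cons]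
  · simp

/-- A nonempty list without repetitions splits at its maximum. -/
theorem exists_append_cons_of_nodup {l : List ℕ} (hl : l.Nodup) (hne : l ≠ []) :
    ∃ l₁ m l₂, l = l₁ ++ m :: l₂ ∧ (∀ x ∈ l₁, x < m) ∧ ∀ x ∈ l₂, x < m := by
  obtain ⟨m, hm, hmax⟩ := l.toFinset.exists_max_image id (by simpa using hne)
  obtain ⟨l₁, l₂, rfl⟩ := List.append_of_mem (List.mem_toFinset.1 hm)
  simp only [List.mem_toFinset, id_eq] at hmax
  have hnd := List.nodup_middle.1 hl
  rw [List.nodup_cons] at hnd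
  refine ⟨l₁, m, l₂, rfl, fun x hx => ?_, fun x hx => ?_⟩
  · exact lt_of_le_of_ne (hmax x (by simp [hx])) fun h => hnd.1 (by simp [← h, hx])
  · exact lt_of_le_of_ne (hmax x (by simp [hx])) fun h => hnd.1 (by simp [← h, hx])

theorem treeOfAux_eq_treeOf {f : ℕ} {l : List ℕ} (hl : l.Nodup) (hf : l.length ≤ f) :
    treeOfAux f l = treeOf l := by
  suffices H : ∀ g f (l : List ℕ), l.Nodup → l.length ≤ f → l.length ≤ g →
      treeOfAux f l = treeOfAux g l from H _ _ l hl hf le_rfl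
  intro g
  induction g with
  | zero =>
    intro f l _ _ hg
    obtain rfl := List.length_eq_zero_iff.1 (Nat.le_zero.1 hg)
    cases f <;> rfl
  | succ g ih =>
    intro f l hl hf hg
    cases f with
    | zero =>
      obtain rfl := List.length_eq_zero_iff.1 (Nat.le_zero.1 hf)
      rfl
    | succ f =>
      rcases eq_or_ne l [] with rfl | hne
      · rfl
      obtain ⟨l₁, m, l₂, rfl, h₁, h₂⟩ := exists_append_cons_of_nodup hl hne
      rw [treeOfAux_append_cons h₁ h₂, treeOfAux_append_cons h₁ h₂]
      have hnd := List.nodup_append.1 hl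
      simp only [List.length_append, List.length_cons] at hf hg
      rw [ih f l₁ hnd.1 (by omega) (by omega),
        ih f l₂ (List.nodup_cons.1 hnd.2.1).2 (by omega) (by omega)]

theorem treeOf_append_cons {l₁ l₂ : List ℕ} {m : ℕ} (hnd₁ : l₁.Nodup) (hnd₂ : l₂.Nodup)
    (h₁ : ∀ x ∈ l₁, x < m) (h₂ : ∀ x ∈ l₂, x < m) :
    treeOf (l₁ ++ m :: l₂) = node m (treeOf l₁) (treeOf l₂) := by
  have hlen : (l₁ ++ m :: l₂).length = (l₁.length + l₂.length) + 1 := by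
    simp only [List.length_append, List.length_cons]; omega
  rw [treeOf, hlen, treeOfAux_append_cons h₁ h₂, treeOfAux_eq_treeOf hnd₁ (by omega),
    treeOfAux_eq_treeOf hnd₂ (by omega)]

theorem treeOf_eq_nil_iff {l : List ℕ} (hl : l.Nodup) : treeOf l = nil ↔ l = [] := by
  refine ⟨fun h => by_contra fun hne => ?_, fun h => h ▸ rfl⟩
  obtain ⟨l₁, m, l₂, rfl, h₁, h₂⟩ := exists_append_cons_of_nodup hl hne
  have hnd := List.nodup_append.1 hl
  rw [treeOf_append_cons hnd.1 (List.nodup_cons.1 hnd.2.1).2 h₁ h₂] at h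
  cases h

theorem canonP_node_iff {m : ℕ} {l r : BT} :
    canonP (node m l r) = true ↔
      canonP l = true ∧ canonP r = true ∧ (l = nil → r = nil) := by
  cases l <;> cases r <;> simp [canonP]

end BT

open BT Finset

/-- The arrangements of a finite set of labels whose decreasing binary tree represents
a plane 1-2 tree. -/
noncomputable def planeLists (S : Finset ℕ) : Finset (List ℕ) :=
  {l ∈ S.toList.permutations.toFinset | canonP (treeOf l) = true}

theorem mem_planeLists {S : Finset ℕ} {l : List ℕ} :
    l ∈ planeLists S ↔ l.Nodup ∧ l.toFinset = S ∧ canonP (treeOf l) = true := by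
  rw [planeLists, mem_filter, List.mem_toFinset, List.mem_permutations, ← and_assoc]
  refine and_congr_left fun _ => ⟨fun h => ⟨h.nodup_iff.2 S.nodup_toList, ?_⟩, fun h => ?_⟩
  · rw [List.toFinset_eq_of_perm _ _ h, toList_toFinset]
  · rw [List.perm_ext_iff_of_nodup h.1 S.nodup_toList]
    intro x
    rw [← List.mem_toFinset, h.2, mem_toList]

theorem z_eq_card_planeLists (n : ℕ) : z n = #(planeLists (Icc 1 n)) := by
  have hnd : (pPerms n).Nodup :=
    (List.nodup_permutations _ List.nodup_range').filter _
  rw [z, ← List.toFinset_card_of_nodup hnd]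
  congr 1
  ext l
  rw [List.mem_toFinset, mem_planeLists, pPerms, List.mem_filter, perms, List.mem_permutations,
    ← and_assoc]
  refine and_congr_left fun _ => ⟨fun h => ⟨h.nodup_iff.2 List.nodup_range', ?_⟩, fun h => ?_⟩
  · ext x
    rw [List.mem_toFinset, h.mem_iff, List.mem_range'_1, mem_Icc]
    omega
  · rw [List.perm_ext_iff_of_nodup h.1 List.nodup_range']
    intro x
    rw [← List.mem_toFinset, h.2, List.mem_range'_1, mem_Icc]
    omega

theorem card_planeLists_empty : #(planeLists ∅) = 1 := by
  rw [card_eq_one]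
  refine ⟨[], ?_⟩
  ext l
  rw [mem_planeLists, mem_singleton]
  constructor
  · rintro ⟨-, h, -⟩
    simpa using h
  · rintro rfl
    exact ⟨List.nodup_nil, rfl, rfl⟩

/-- Removing the maximum `m` splits a plane 1-2 tree into an ordered pair of such trees, where
the first is empty only if the second is. -/
theorem card_planeLists_insert {T : Finset ℕ} {m : ℕ} (hm : ∀ x ∈ T, x < m) :
    #(planeLists (insert m T)) =
      ∑ A ∈ T.powerset,
        if A = ∅ → T = ∅ then #(planeLists A) * #(planeLists (T \ A)) else 0 := by
  have hsum : ∀ A ∈ T.powerset,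
      (if A = ∅ → T = ∅ then #(planeLists A) * #(planeLists (T \ A)) else 0) =
        #(if A = ∅ → T = ∅ then planeLists A ×ˢ planeLists (T \ A) else ∅) := by
    intro A _
    split_ifs <;> simp
  rw [sum_congr rfl hsum, ← card_sigma]
  symm
  have hmem : ∀ q : (Σ _ : Finset ℕ, List ℕ × List ℕ),
      q ∈ T.powerset.sigma (fun A =>
        if A = ∅ → T = ∅ then planeLists A ×ˢ planeLists (T \ A) else ∅) ↔
      q.1 ⊆ T ∧ (q.1 = ∅ → T = ∅) ∧ q.2.1 ∈ planeLists q.1 ∧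
        q.2.2 ∈ planeLists (T \ q.1) := by
    rintro ⟨A, l₁, l₂⟩
    simp only [mem_sigma, mem_powerset]
    split_ifs with h
    · rw [mem_product]
      tauto
    · simp [h]
  have hlt : ∀ q : (Σ _ : Finset ℕ, List ℕ × List ℕ), q.1 ⊆ T → q.2.1 ∈ planeLists q.1 →
      q.2.2 ∈ planeLists (T \ q.1) → (∀ x ∈ q.2.1, x < m) ∧ ∀ x ∈ q.2.2, x < m := by
    rintro ⟨A, l₁, l₂⟩ hA h₁ h₂
    rw [mem_planeLists] at h₁ h₂
    refine ⟨fun x hx => hm x (hA ?_), fun x hx => hm x (mem_sdiff.1 (?_ : x ∈ T \ A)).1⟩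
    · rw [← h₁.2.1]; simpa using hx
    · rw [← h₂.2.1]; simpa using hx
  refine card_bij (fun q _ => q.2.1 ++ m :: q.2.2) ?_ ?_ ?_
  · intro q hq
    obtain ⟨hA, hT, h₁, h₂⟩ := (hmem q).1 hq
    obtain ⟨hlt₁, hlt₂⟩ := hlt q hA h₁ h₂
    obtain ⟨A, l₁, l₂⟩ := q
    rw [mem_planeLists] at h₁ h₂ ⊢
    obtain ⟨hnd₁, hs₁, hc₁⟩ := h₁
    obtain ⟨hnd₂, hs₂, hc₂⟩ := h₂
    dsimp only at *
    refine ⟨?_, ?_, ?_⟩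
    · rw [List.nodup_middle, List.nodup_cons, List.nodup_append']
      refine ⟨fun h => ?_, hnd₁, hnd₂, ?_⟩
      · rcases List.mem_append.1 h with h | h
        · exact lt_irrefl _ (hlt₁ _ h)
        · exact lt_irrefl _ (hlt₂ _ h)
      · rw [← List.disjoint_toFinset_iff_disjoint, hs₁, hs₂]
        exact disjoint_sdiff
    · ext x
      have := congrArg (x ∈ ·) hs₁
      have := congrArg (x ∈ ·) hs₂
      have := @hA x
      simp only [List.mem_toFinset, mem_sdiff, eq_iff_iff] at *
      simp only [List.mem_append, List.mem_cons, mem_insert]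
      tauto
    · rw [treeOf_append_cons hnd₁ hnd₂ hlt₁ hlt₂, canonP_node_iff, treeOf_eq_nil_iff hnd₁,
        treeOf_eq_nil_iff hnd₂]
      refine ⟨hc₁, hc₂, fun h => ?_⟩
      subst h
      have hT' := hT (by rw [← hs₁]; rfl)
      rw [hT'] at hs₂
      simpa using hs₂
  · intro q hq q' hq' heq
    obtain ⟨hA, -, h₁, h₂⟩ := (hmem q).1 hq
    obtain ⟨hlt₁, hlt₂⟩ := hlt q hA h₁ h₂
    obtain ⟨hA', -, h₁', h₂'⟩ := (hmem q').1 hq'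
    obtain ⟨hlt₁', hlt₂'⟩ := hlt q' hA' h₁' h₂'
    obtain ⟨A, l₁, l₂⟩ := q
    obtain ⟨A', l₁', l₂'⟩ := q'
    dsimp only at *
    have hl₁ : m ∉ l₁ := fun h => lt_irrefl _ (hlt₁ _ h)
    have hl₁' : m ∉ l₁' := fun h => lt_irrefl _ (hlt₁' _ h)
    have hl₂ : m ∉ l₂ := fun h => lt_irrefl _ (hlt₂ _ h)
    obtain ⟨rfl, rfl⟩ : l₁ = l₁' ∧ l₂ = l₂' := by
      rcases List.append_eq_append_iff.1 heq with ⟨c, hc, hc'⟩ | ⟨c, hc, hc'⟩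
      · cases c with
        | nil => simp_all
        | cons a c => simp_all
      · cases c with
        | nil => simp_all
        | cons a c => simp_all
    obtain rfl : A = A' := by
      rw [← (mem_planeLists.1 h₁).2.1, ← (mem_planeLists.1 h₁').2.1]
    rfl
  · intro l hl
    obtain ⟨hnd, hs, hc⟩ := mem_planeLists.1 hl
    have hml : m ∈ l := by rw [← List.mem_toFinset, hs]; exact mem_insert_self _ _
    obtain ⟨l₁, l₂, rfl⟩ := List.append_of_mem hml
    have hnd' := List.nodup_middle.1 hnd
    rw [List.nodup_cons, List.nodup_append', List.mem_append, not_or] at hnd'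
    obtain ⟨⟨hm₁, hm₂⟩, hnd₁, hnd₂, hdisj⟩ := hnd'
    have hs' : ∀ x, (x ∈ l₁ ∨ x = m ∨ x ∈ l₂) ↔ (x = m ∨ x ∈ T) := by
      intro x
      rw [← mem_insert, ← hs]; simp [or_left_comm]
    have hmT : m ∉ T := fun h => lt_irrefl _ (hm m h)
    have hsub₁ : ∀ x ∈ l₁, x ∈ T := fun x hx =>
      ((hs' x).1 (Or.inl hx)).resolve_left fun h => hm₁ (h ▸ hx)
    have hsub₂ : ∀ x ∈ l₂, x ∈ T := fun x hx =>
      ((hs' x).1 (Or.inr (Or.inr hx))).resolve_left fun h => hm₂ (h ▸ hx)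
    have hT : l₂.toFinset = T \ l₁.toFinset := by
      ext x
      have := hs' x
      have := hsub₂ x
      have := @hdisj x
      have : x = m → x ∉ T := fun h => h ▸ hmT
      simp only [List.mem_toFinset, mem_sdiff]
      tauto
    rw [treeOf_append_cons hnd₁ hnd₂ (fun x hx => hm x (hsub₁ x hx))
      (fun x hx => hm x (hsub₂ x hx)), canonP_node_iff, treeOf_eq_nil_iff hnd₁,
      treeOf_eq_nil_iff hnd₂] at hc
    refine ⟨⟨l₁.toFinset, l₁, l₂⟩, (hmem _).2 ⟨?_, ?_, ?_, ?_⟩, rfl⟩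
    · intro x hx
      exact hsub₁ x (List.mem_toFinset.1 hx)
    · intro h
      dsimp only at h
      have h₁ : l₁ = [] := by simpa using h
      have h₂ := hc.2.2 h₁
      rw [h₁, h₂] at hT
      simpa using hT.symm
    · exact mem_planeLists.2 ⟨hnd₁, rfl, hc.1⟩
    · exact mem_planeLists.2 ⟨hnd₂, hT, hc.2.1⟩

/-- The number of plane 1-2 trees depends only on the number of labels. -/
theorem card_planeLists (S : Finset ℕ) : #(planeLists S) = z #S := by
  suffices H : ∀ n, ∀ S S' : Finset ℕ, #S = n → #S' = n →
      #(planeLists S) = #(planeLists S') by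
    rw [z_eq_card_planeLists]
    exact H _ S _ rfl (by simp)
  intro n
  induction n using Nat.strong_induction_on with
  | _ n ih =>
    have step : ∀ S : Finset ℕ, #S = n → S.Nonempty → #(planeLists S) =
        ∑ k ∈ Finset.range n, (n - 1).choose k *
          if k = 0 → n - 1 = 0 then
            #(planeLists (Finset.range k)) * #(planeLists (Finset.range (n - 1 - k))) else 0 := by
      intro S hS hne
      have hcard : #(S.erase (S.max' hne)) = n - 1 := by
        rw [card_erase_of_mem (S.max'_mem hne), hS]
      have hpos : 0 < n := hS ▸ hne.card_pos
      rw [← insert_erase (S.max'_mem hne), card_planeLists_insert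
        fun x hx => lt_of_le_of_ne (S.le_max' x (mem_of_mem_erase hx)) (ne_of_mem_erase hx)]
      generalize S.erase (S.max' hne) = T at hcard
      have hrange : Finset.range n = Finset.range (#T + 1) := by rw [hcard]; congr 1; omega
      rw [hrange, ← hcard]
      simp only [← smul_eq_mul (a := Nat.choose _ _)]
      rw [← sum_powerset_apply_card (fun k => if k = 0 → #T = 0 then
            #(planeLists (Finset.range k)) * #(planeLists (Finset.range (#T - k))) else 0)]
      refine sum_congr rfl fun A hA => ?_
      rw [mem_powerset] at hA
      have hAc := card_le_card hA
      simp only [card_eq_zero]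
      rw [ih #A (by omega) A (Finset.range #A) rfl (by simp),
        ih #(T \ A) (by rw [card_sdiff_of_subset hA]; omega) (T \ A) (Finset.range (#T - #A)) rfl
          (by rw [card_sdiff_of_subset hA]; simp)]
    intro S S' hS hS'
    rcases S.eq_empty_or_nonempty with rfl | hne
    · obtain rfl : S' = ∅ := by
        rw [← card_eq_zero, hS', ← hS, card_empty]
      rfl
    · have hne' : S'.Nonempty := by
        rw [← card_pos, hS', ← hS]; exact hne.card_pos
      rw [step S hS hne, step S' hS' hne']

theorem z_zero : z 0 = 1 := by
  rw [← card_empty (α := ℕ), ← card_planeLists, card_planeLists_empty]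

/-- The recurrence encoding the differential equation `dZ/dx = Z² - Z + 1`. -/
theorem z_succ_add (n : ℕ) :
    z (n + 1) + z n =
      (∑ k ∈ Finset.range (n + 1), n.choose k * (z k * z (n - k))) + if n = 0 then 1 else 0 := by
  have h := card_planeLists_insert (T := Finset.range n) (m := n) fun x hx => mem_range.1 hx
  rw [card_planeLists, card_insert_of_notMem (by simp), card_range] at h
  have h' : ∀ A ∈ (Finset.range n).powerset,
      (if A = ∅ → Finset.range n = ∅ then
        #(planeLists A) * #(planeLists (Finset.range n \ A)) else 0) =
      if #A = 0 → n = 0 then z #A * z (n - #A) else 0 := by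
    intro A hA
    rw [card_planeLists, card_planeLists, card_sdiff_of_subset (mem_powerset.1 hA), card_range]
    simp
  rw [sum_congr rfl h', sum_powerset_apply_card
    (fun k => if k = 0 → n = 0 then z k * z (n - k) else 0), card_range] at h
  rw [h, sum_range_succ', sum_range_succ' (fun k => n.choose k * (z k * z (n - k)))]
  rcases eq_or_ne n 0 with rfl | hn
  · simp [z_zero]
  · simp [hn, z_zero]

end BalancedTrees
namespace BalancedTrees

open Complex

/-- Uniqueness of the power series solution of `dZ/dx = Z² - Z + 1`, `Z(0) = 1`. -/
theorem iteratedDeriv_eq_z {f : ℂ → ℂ} (hf : AnalyticAt ℂ f 0) (h0 : f 0 = 1)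
    (hode : deriv f =ᶠ[nhds 0] fun x => f x * f x - f x + 1) (n : ℕ) :
    iteratedDeriv n f 0 = z n := by
  induction n using Nat.strong_induction_on with
  | _ n ih =>
    cases n with
    | zero => simp [h0, z_zero]
    | succ n =>
      have hc : ContDiffAt ℂ n f 0 := hf.contDiffAt
      rw [iteratedDeriv_succ', hode.iteratedDeriv_eq,
        iteratedDeriv_fun_add ((hc.mul hc).sub hc) contDiffAt_const,
        iteratedDeriv_fun_sub (hc.mul hc) hc, iteratedDeriv_fun_mul hc hc, iteratedDeriv_const,
        ih n n.lt_succ_self]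
      have hz := congrArg (Nat.cast : ℕ → ℂ) (z_succ_add n)
      push_cast at hz
      rw [sub_add_eq_add_sub, eq_comm, eq_sub_iff_add_eq, hz]
      congr 1
      refine Finset.sum_congr rfl fun k hk => ?_
      rw [Finset.mem_range] at hk
      rw [ih k hk, ih (n - k) (by omega), mul_assoc]

/-- If the generating function `f` of `u` becomes holomorphic on a disc of radius larger than
`ρ` after multiplication by `ρ - x`, then its coefficients are asymptotic to those of
`G ρ / (ρ - x)`. -/
theorem tendsto_iteratedDeriv_mul_pow {f G : ℂ → ℂ} {ρ : ℂ} {R : ℝ} (hρ : ‖ρ‖ < R)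
    (hG : DifferentiableOn ℂ G (Metric.ball 0 R)) (hf : AnalyticAt ℂ f 0)
    (hfG : G =ᶠ[nhds 0] fun x => (ρ - x) * f x) :
    Filter.Tendsto (fun n : ℕ => iteratedDeriv n f 0 / n.factorial * ρ ^ (n + 1)) Filter.atTop
      (nhds (G ρ)) := by
  have hsum := (hasSum_taylorSeries_on_ball hG (z := ρ) (by simpa using hρ)).tendsto_sum_nat
  have hlin : ∀ k, iteratedDeriv k (fun x : ℂ => ρ - x) 0 =
      if k = 0 then ρ else if k = 1 then -1 else 0 := by
    intro k
    rw [iteratedDeriv_fun_sub contDiffAt_const contDiffAt_fun_id, iteratedDeriv_const,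
      iteratedDeriv_fun_id]
    split_ifs <;> simp
  have hcoef : ∀ n, iteratedDeriv n G 0 =
      ρ * iteratedDeriv n f 0 - n * iteratedDeriv (n - 1) f 0 := by
    intro n
    rw [hfG.iteratedDeriv_eq,
      iteratedDeriv_fun_mul (contDiffAt_const.sub contDiffAt_fun_id) hf.contDiffAt]
    cases n with
    | zero => simp
    | succ n =>
      rw [Finset.sum_range_succ', Finset.sum_range_succ', Finset.sum_eq_zero]
      · simp [hlin]
        ring
      · intro k _
        simp [hlin]
  have hpartial : ∀ n : ℕ, ∑ k ∈ Finset.range (n + 1),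
      (k.factorial : ℂ)⁻¹ • (ρ - 0) ^ k • iteratedDeriv k G 0 =
        iteratedDeriv n f 0 / n.factorial * ρ ^ (n + 1) := by
    intro n
    induction n with
    | zero => simp [hcoef]; ring
    | succ n ih =>
      rw [Finset.sum_range_succ, ih, hcoef, Nat.factorial_succ]
      have h₁ : (n.factorial : ℂ) ≠ 0 := Nat.cast_ne_zero.2 n.factorial_ne_zero
      have h₂ : (n : ℂ) + 1 ≠ 0 := Nat.cast_add_one_ne_zero n
      simp only [smul_eq_mul, sub_zero, Nat.add_sub_cancel]
      push_cast
      field_simp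
      ring
  exact ((Filter.tendsto_add_atTop_iff_nat 1).2 hsum).congr hpartial

/-- The denominator of the exponential generating function of `z`. -/
noncomputable def egfDenom (x : ℂ) : ℂ := cos ((√3 / 2 : ℝ) * x + (Real.pi / 6 : ℝ))

/-- The numerator of the exponential generating function of `z`. -/
noncomputable def egfNum (x : ℂ) : ℂ := cos ((√3 / 2 : ℝ) * x - (Real.pi / 6 : ℝ))

theorem hasDerivAt_egfDenom (x : ℂ) :
    HasDerivAt egfDenom (-sin ((√3 / 2 : ℝ) * x + (Real.pi / 6 : ℝ)) * (√3 / 2 : ℝ)) x := by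
  have h := (((hasDerivAt_id x).const_mul ((√3 / 2 : ℝ) : ℂ)).add_const
    ((Real.pi / 6 : ℝ) : ℂ)).ccos
  simp only [mul_one, id_eq] at h
  exact h

theorem hasDerivAt_egfNum (x : ℂ) :
    HasDerivAt egfNum (-sin ((√3 / 2 : ℝ) * x - (Real.pi / 6 : ℝ)) * (√3 / 2 : ℝ)) x := by
  have h := (((hasDerivAt_id x).const_mul ((√3 / 2 : ℝ) : ℂ)).sub_const
    ((Real.pi / 6 : ℝ) : ℂ)).ccos
  simp only [mul_one, id_eq] at h
  exact h

theorem egfDenom_zero : egfDenom 0 = (√3 / 2 : ℝ) := by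
  rw [egfDenom, mul_zero, zero_add, ← ofReal_cos, Real.cos_pi_div_six]

theorem egfNum_zero : egfNum 0 = (√3 / 2 : ℝ) := by
  rw [egfNum, mul_zero, zero_sub, cos_neg, ← ofReal_cos, Real.cos_pi_div_six]

theorem deriv_egf {x : ℂ} (hx : egfDenom x ≠ 0) :
    deriv (fun x => egfNum x / egfDenom x) x =
      egfNum x / egfDenom x * (egfNum x / egfDenom x) - egfNum x / egfDenom x + 1 := by
  rw [((hasDerivAt_egfNum x).fun_div (hasDerivAt_egfDenom x) hx).deriv]
  have key : -sin ((√3 / 2 : ℝ) * x - (Real.pi / 6 : ℝ)) * (√3 / 2 : ℝ) * egfDenom x -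
      egfNum x * (-sin ((√3 / 2 : ℝ) * x + (Real.pi / 6 : ℝ)) * (√3 / 2 : ℝ)) =
      egfNum x ^ 2 - egfNum x * egfDenom x + egfDenom x ^ 2 := by
    rw [egfNum, egfDenom, sin_sub, sin_add, cos_sub, cos_add, ← ofReal_cos, ← ofReal_sin,
      Real.cos_pi_div_six, Real.sin_pi_div_six]
    have h3 : ((√3 / 2 : ℝ) : ℂ) ^ 2 = 3 / 4 := by
      rw [← ofReal_pow, div_pow, Real.sq_sqrt (by norm_num)]; push_cast; norm_num
    generalize sin (((√3 / 2 : ℝ) : ℂ) * x) = s at *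
    generalize cos (((√3 / 2 : ℝ) : ℂ) * x) = c at *
    generalize ((√3 / 2 : ℝ) : ℂ) = q at *
    push_cast
    linear_combination s ^ 2 * h3
  rw [key]
  field_simp

/-- The dominant singularity of the exponential generating function of `z`. -/
noncomputable def radius : ℝ := 2 * Real.pi / (3 * √3)

theorem radius_pos : 0 < radius := by
  have := Real.pi_pos
  unfold radius
  positivity

theorem sqrt_three_mul_radius : √3 / 2 * radius = Real.pi / 3 := by
  unfold radius
  have : √3 ≠ 0 := by positivity
  field_simp

/-- Within the disc of radius `2 * radius`, the denominator vanishes only at `radius`. -/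
theorem eq_radius_of_egfDenom_eq_zero {x : ℂ} (hx : ‖x‖ < 2 * radius) (h : egfDenom x = 0) :
    x = radius := by
  obtain ⟨k, hk⟩ := cos_eq_zero_iff.1 h
  have hs : ((√3 / 2 : ℝ) : ℂ) ≠ 0 := ofReal_ne_zero.2 (by positivity)
  have hxk : x = ((1 + 3 * k : ℤ) : ℝ) * (radius : ℂ) := by
    apply mul_left_cancel₀ hs
    rw [mul_left_comm, ← ofReal_mul (√3 / 2), sqrt_three_mul_radius, eq_sub_of_add_eq hk]
    push_cast
    ring
  have hr := radius_pos
  rw [hxk, norm_mul, norm_real, norm_real, Real.norm_of_nonneg hr.le,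
    mul_lt_mul_iff_left₀ hr, Real.norm_eq_abs, ← Int.cast_abs] at hx
  have hlt : |1 + 3 * k| < 2 := by exact_mod_cast hx
  rw [abs_lt] at hlt
  obtain rfl : k = 0 := by omega
  simpa using hxk

theorem egfDenom_radius : egfDenom radius = 0 := by
  rw [egfDenom, ← ofReal_mul, sqrt_three_mul_radius, ← ofReal_add, ← ofReal_cos,
    show Real.pi / 3 + Real.pi / 6 = Real.pi / 2 by ring, Real.cos_pi_div_two, ofReal_zero]

theorem deriv_egfDenom_radius : deriv egfDenom radius = -(√3 / 2 : ℝ) := by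
  rw [(hasDerivAt_egfDenom _).deriv, ← ofReal_mul, sqrt_three_mul_radius, ← ofReal_add,
    ← ofReal_sin, show Real.pi / 3 + Real.pi / 6 = Real.pi / 2 by ring, Real.sin_pi_div_two]
  simp

theorem egfNum_radius : egfNum radius = (√3 / 2 : ℝ) := by
  rw [egfNum, ← ofReal_mul, sqrt_three_mul_radius, ← ofReal_sub, ← ofReal_cos,
    show Real.pi / 3 - Real.pi / 6 = Real.pi / 6 by ring, Real.cos_pi_div_six]

theorem tendsto_z_div_factorial :
    Filter.Tendsto (fun n : ℕ => (z n : ℂ) / n.factorial * (radius : ℂ) ^ (n + 1)) Filter.atTop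
      (nhds 1) := by
  have hs : ((√3 / 2 : ℝ) : ℂ) ≠ 0 := ofReal_ne_zero.2 (by positivity)
  have hr := radius_pos
  have hdD : Differentiable ℂ egfDenom := fun x => (hasDerivAt_egfDenom x).differentiableAt
  have hdN : Differentiable ℂ egfNum := fun x => (hasDerivAt_egfNum x).differentiableAt
  have h0 : egfDenom 0 ≠ 0 := egfDenom_zero ▸ hs
  have hf : AnalyticAt ℂ (fun x => egfNum x / egfDenom x) 0 :=
    (hdN.analyticAt 0).fun_div (hdD.analyticAt 0) h0
  have hval : -egfNum radius / dslope egfDenom radius radius = 1 := by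
    rw [dslope_same, deriv_egfDenom_radius, egfNum_radius, neg_div_neg_eq, div_self hs]
  have hslope : ∀ x : ℂ, x ≠ radius → dslope egfDenom radius x = egfDenom x / (x - radius) := by
    intro x hx
    rw [dslope_of_ne _ hx, slope_def_field, egfDenom_radius, sub_zero]
  have hne : ∀ x ∈ Metric.ball (0 : ℂ) (2 * radius), dslope egfDenom radius x ≠ 0 := by
    intro x hx
    rcases eq_or_ne x radius with rfl | hxr
    · rw [dslope_same, deriv_egfDenom_radius]
      exact neg_ne_zero.2 hs
    · rw [hslope x hxr]
      exact div_ne_zero (fun h => hxr (eq_radius_of_egfDenom_eq_zero (by simpa using hx) h))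
        (sub_ne_zero.2 hxr)
  have hmem : (radius : ℂ) ∈ Metric.ball (0 : ℂ) (2 * radius) := by
    rw [mem_ball_zero_iff, norm_real, Real.norm_of_nonneg hr.le]
    linarith
  have hG : DifferentiableOn ℂ (fun x => -egfNum x / dslope egfDenom radius x)
      (Metric.ball 0 (2 * radius)) :=
    hdN.neg.differentiableOn.fun_div
      ((differentiableOn_dslope (Metric.isOpen_ball.mem_nhds hmem)).2 hdD.differentiableOn) hne
  have hfG : (fun x => -egfNum x / dslope egfDenom radius x) =ᶠ[nhds 0]
      fun x => (radius - x) * (egfNum x / egfDenom x) := by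
    have hr0 : (0 : ℂ) ≠ radius := (ofReal_ne_zero.2 hr.ne').symm
    filter_upwards [isOpen_ne.mem_nhds hr0] with x hx
    rw [hslope x hx, div_div_eq_mul_div, ← neg_sub x]
    ring
  have hode : deriv (fun x => egfNum x / egfDenom x) =ᶠ[nhds 0] fun x =>
      egfNum x / egfDenom x * (egfNum x / egfDenom x) - egfNum x / egfDenom x + 1 := by
    filter_upwards [hdD.continuous.continuousAt.eventually_ne h0] with x hx using deriv_egf hx
  have key := tendsto_iteratedDeriv_mul_pow (mem_ball_zero_iff.1 hmem) hG hf hfG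
  rw [hval] at key
  refine key.congr fun n => ?_
  rw [iteratedDeriv_eq_z hf (by rw [egfNum_zero, egfDenom_zero, div_self hs]) hode]

end BalancedTrees

/-- The numbers `z(n)` of plane 1-2 trees satisfy
`z(n) ~ n! * (3√3/(2π))^(n+1)` as `n → ∞`; that is,
`lim_{n→∞} (z(n)/n!) * (2π/(3√3))^(n+1) = 1`. -/
theorem statement16 :
    Filter.Tendsto
      (fun n : ℕ =>
        (z n : ℝ) / (Nat.factorial n : ℝ) *
          (2 * Real.pi / (3 * Real.sqrt 3)) ^ (n + 1))
      Filter.atTop (nhds 1) := by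
  have h := (Complex.continuous_re.tendsto _).comp tendsto_z_div_factorial
  rw [Complex.one_re] at h
  refine h.congr fun n => ?_
  rw [← radius, Function.comp_apply]
  rw [← Complex.ofReal_re ((z n : ℝ) / n.factorial * radius ^ (n + 1))]
  push_cast
  rfl
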